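/- Let n : ℕ and let ⟨·,·⟩ denote the Minkowski bilinear form on ℝ^{n+1}. There do not exist vectors K, Γ₀, Γ₁, F : Fin (n+1) → ℝ such that ⟨K,K⟩ = −2, ⟨K,Γ₀⟩ = 2, ⟨K,Γ₁⟩ = 4, ⟨Γ₀,Γ₀⟩ = 2, ⟨Γ₁,Γ₁⟩ = −4, ⟨Γ₀,Γ₁⟩ = 0, ⟨F,K⟩ = −2, ⟨F,Γ₀⟩ + ⟨F,Γ₁⟩ = 12, and ⟨F,Γ₀⟩ = 2m for some integer m. -/

import Mathlib

/-- The Minkowski (Lorentzian) bilinear form on `ℝ^{n+1}`: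
`⟨x, y⟩ = x 0 * y 0 - ∑_{i=1}^{n} x i * y i`. -/
def mink (n : ℕ) (x y : Fin (n + 1) → ℝ) : ℝ :=
  x 0 * y 0 - ∑ i ∈ Finset.Ioi (0 : Fin (n + 1)), x i * y i

theorem mink_null_orth (n : ℕ) (D G : Fin (n + 1) → ℝ) (hG : 0 < mink n G G)
    (hDG : mink n D G = 0) (hDD : mink n D D = 0) : D = 0 := by
  unfold mink at hG hDG hDD
  have cs := Finset.sum_mul_sq_le_sq_mul_sq (Finset.Ioi (0 : Fin (n + 1))) D G
  simp only [← pow_two] at hG hDD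
  have h0 : D 0 = 0 := by
    by_contra hne
    have hpos : 0 < D 0 ^ 2 := by positivity
    have e1 : ∑ i ∈ Finset.Ioi (0 : Fin (n + 1)), D i * G i = D 0 * G 0 := by linarith
    have e2 : ∑ i ∈ Finset.Ioi (0 : Fin (n + 1)), D i ^ 2 = D 0 ^ 2 := by linarith
    rw [e1, e2] at cs
    nlinarith [mul_pos hpos hG]
  have hs : ∑ i ∈ Finset.Ioi (0 : Fin (n + 1)), D i ^ 2 = 0 := by
    rw [h0] at hDD; linarith
  rw [Finset.sum_eq_zero_iff_of_nonneg (fun i _ => sq_nonneg _)] at hs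
  funext i
  by_cases hi : i = 0
  · rw [hi]; exact h0
  · have := hs i (Finset.mem_Ioi.mpr (Fin.pos_iff_ne_zero.mpr hi))
    simpa using this

theorem mink_comm' (n : ℕ) (x y : Fin (n + 1) → ℝ) : mink n x y = mink n y x := by
  simp [mink, mul_comm]

theorem mink_comb (n : ℕ) (x a b c : Fin (n + 1) → ℝ) :
    mink n x (a + b - c) = mink n x a + mink n x b - mink n x c := by
  simp only [mink, Pi.add_apply, Pi.sub_apply, mul_add, mul_sub, Finset.sum_add_distrib,
    Finset.sum_sub_distrib]
  ring

/-- Exclusion of case (f) for `k = 9`. -/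
theorem exclusion_case_f (n : ℕ) :
    ¬ ∃ (K Γ₀ Γ₁ F : Fin (n + 1) → ℝ) (m : ℤ),
      mink n K K = -2 ∧ mink n K Γ₀ = 2 ∧ mink n K Γ₁ = 4 ∧
      mink n Γ₀ Γ₀ = 2 ∧ mink n Γ₁ Γ₁ = -4 ∧ mink n Γ₀ Γ₁ = 0 ∧
      mink n F K = -2 ∧ mink n F Γ₀ + mink n F Γ₁ = 12 ∧
      mink n F Γ₀ = 2 * (m : ℝ) := by
  rintro ⟨K, A, B, F, m, hKK, hKA, hKB, hAA, hBB, hAB, hFK, hF, hm⟩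
  have hAK := mink_comm' n A K
  have hBK := mink_comm' n B K
  have hBA := mink_comm' n B A
  have hD : K + B - A = 0 := by
    apply mink_null_orth n _ A (by linarith)
    · rw [mink_comm', mink_comb]; linarith
    · rw [mink_comb, mink_comm' n _ K, mink_comm' n _ B, mink_comm' n _ A]
      simp only [mink_comb]; linarith
  have h := mink_comb n F K B A
  rw [hD] at h
  have hz : mink n F 0 = 0 := by simp [mink]
  have h5 : (2 * m : ℝ) = 5 := by linarith
  have h6 : 2 * m = 5 := by exact_mod_cast h5
  omega
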